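/- arXiv:2504.07820 — 3 statements merged into one kernel-verified Lean document; each statement's English description precedes it below -/
import Mathlib

section
/- For m ≥ 1, the function abs * M_{m,ε} (with M_{m,ε}(x) = (1/ε)M_m(x/ε)) is the Moreau envelope of some proper, convex, lower semi-continuous function g : ℝ → ℝ if and only if ε ≥ 2 M_m(0). -/
open MeasureTheory

/-- The centered cardinal B-spline of order `m`. -/
noncomputable def Mspline : ℕ → ℝ → ℝ
  | 0 => fun _ => 0
  | 1 => (Set.Icc (-(1:ℝ)/2) (1/2)).indicator (fun _ => 1)
  | (m + 2) => fun x => ∫ y, Mspline 1 (x - y) * Mspline (m + 1) y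

/-- A compactly supported, even, unimodal, integrable density which is continuous at its mode. -/
structure IsEvenBump (f : ℝ → ℝ) : Prop where
  nonneg : ∀ x, 0 ≤ f x
  even : ∀ x, f (-x) = f x
  antitoneOn : AntitoneOn f (Set.Ici 0)
  continuousAt : ContinuousAt f 0
  integrable : Integrable f
  support : ∃ R, 0 ≤ R ∧ ∀ x, R < |x| → f x = 0

namespace IsEvenBump

variable {f : ℝ → ℝ}

lemma apply_abs (hf : IsEvenBump f) (x : ℝ) : f |x| = f x := by
  rcases abs_choice x with h | h <;> rw [h]
  exact hf.even x

lemma le_of_abs_le (hf : IsEvenBump f) {x y : ℝ} (h : |x| ≤ |y|) : f y ≤ f x := by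
  rw [← hf.apply_abs x, ← hf.apply_abs y]
  exact hf.antitoneOn (abs_nonneg x) (abs_nonneg y) h

lemma le_apply_zero (hf : IsEvenBump f) (x : ℝ) : f x ≤ f 0 :=
  hf.le_of_abs_le (by simp)

lemma indicator_Icc : IsEvenBump ((Set.Icc (-(1:ℝ)/2) (1/2)).indicator (fun _ => 1)) where
  nonneg x := Set.indicator_nonneg (fun _ _ => zero_le_one) x
  even x := by
    simp only [Set.indicator_apply, Set.mem_Icc]
    congr 1
    apply propext
    constructor <;> rintro ⟨h₁, h₂⟩ <;> constructor <;> linarith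
  antitoneOn := by
    intro x hx y hy hxy
    simp only [Set.mem_Ici] at hx hy
    simp only [Set.indicator_apply, Set.mem_Icc]
    split_ifs with h₁ h₂ <;> norm_num
    exact h₂ ⟨by linarith, by linarith [h₁.2]⟩
  continuousAt := by
    have h : (Set.Icc (-(1:ℝ)/2) (1/2)).indicator (fun _ => (1:ℝ)) =ᶠ[nhds 0] fun _ => 1 := by
      filter_upwards [Icc_mem_nhds (show -(1:ℝ)/2 < 0 by norm_num) (show (0:ℝ) < 1/2 by norm_num)]
        with x hx
      exact Set.indicator_of_mem hx _
    exact continuousAt_const.congr h.symm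
  integrable := by
    rw [integrable_indicator_iff measurableSet_Icc]
    exact integrableOn_const (by simp)
  support := by
    refine ⟨1/2, by norm_num, fun x hx => Set.indicator_of_notMem (fun h => ?_) _⟩
    have : |x| ≤ 1/2 := abs_le.2 ⟨by linarith [h.1], h.2⟩
    linarith

lemma convolution_box (hf : IsEvenBump f) :
    IsEvenBump (fun x => ∫ y in (x - 1/2)..(x + 1/2), f y) := by
  have hint : ∀ a b, IntervalIntegrable f volume a b := fun a b => hf.integrable.intervalIntegrable
  have hcont : Continuous (fun x : ℝ => ∫ y in (x - 1/2)..(x + 1/2), f y) := by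
    have hP : Continuous (fun b => ∫ y in (0:ℝ)..b, f y) :=
      intervalIntegral.continuous_primitive hint 0
    have h : (fun x : ℝ => ∫ y in (x - 1/2)..(x + 1/2), f y)
        = fun x => (∫ y in (0:ℝ)..(x + 1/2), f y) - ∫ y in (0:ℝ)..(x - 1/2), f y := by
      funext x
      rw [intervalIntegral.integral_interval_sub_left (hint _ _) (hint _ _)]
    rw [h]
    exact (hP.comp (by fun_prop)).sub (hP.comp (by fun_prop))
  obtain ⟨R, hR, hsupp⟩ := hf.support
  have hzero : ∀ x, R + 1/2 < |x| → ∫ y in (x - 1/2)..(x + 1/2), f y = 0 := by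
    intro x hx
    refine intervalIntegral.integral_zero_ae (Filter.Eventually.of_forall fun y hy => hsupp y ?_)
    rw [Set.uIoc_of_le (by linarith)] at hy
    have : |x - y| ≤ 1/2 := abs_le.2 ⟨by linarith [hy.2], by linarith [hy.1]⟩
    have := abs_sub_abs_le_abs_sub x y
    linarith
  refine ⟨fun x => intervalIntegral.integral_nonneg (by linarith) fun y _ => hf.nonneg y, ?_, ?_,
    hcont.continuousAt, ?_, R + 1/2, by linarith, hzero⟩
  · intro x
    have h := intervalIntegral.integral_comp_neg (a := x - 1/2) (b := x + 1/2) f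
    simp only [hf.even] at h
    rw [h]
    congr 1 <;> ring
  · intro x hx x' _ hxx'
    simp only [Set.mem_Ici] at hx
    have h₁ : (∫ y in (x - 1/2)..(x + 1/2), f y) - ∫ y in (x' - 1/2)..(x' + 1/2), f y
        = (∫ y in (x - 1/2)..(x' - 1/2), f y) - ∫ y in (x + 1/2)..(x' + 1/2), f y :=
      intervalIntegral.integral_interval_sub_interval_comm (hint _ _) (hint _ _) (hint _ _)
    have h₂ : (∫ y in (x + 1/2)..(x' + 1/2), f y) ≤ ∫ y in (x - 1/2)..(x' - 1/2), f y := by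
      rw [← intervalIntegral.integral_comp_add_right f, ← intervalIntegral.integral_comp_sub_right f]
      refine intervalIntegral.integral_mono_on hxx'
        (hf.integrable.comp_add_right _).intervalIntegrable
        (hf.integrable.comp_sub_right _).intervalIntegrable fun t ht => hf.le_of_abs_le ?_
      have ht0 : 0 ≤ t := hx.trans ht.1
      rw [abs_of_nonneg (show 0 ≤ t + 1/2 by linarith)]
      exact abs_le.2 ⟨by linarith, by linarith⟩
    simp only
    linarith
  · refine hcont.integrable_of_hasCompactSupport
      (HasCompactSupport.intro (isCompact_Icc (a := -(R + 1/2)) (b := R + 1/2)) fun x hx => ?_)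
    refine hzero x ?_
    by_contra h
    exact hx (abs_le.1 (not_lt.1 h))

lemma comp_div (hf : IsEvenBump f) {ε : ℝ} (hε : 0 < ε) :
    IsEvenBump (fun y => (1 / ε) * f (y / ε)) := by
  obtain ⟨R, hR, hsupp⟩ := hf.support
  refine ⟨fun x => mul_nonneg (by positivity) (hf.nonneg _), fun x => ?_, ?_, ?_,
    (hf.integrable.comp_div hε.ne').const_mul _, R * ε, by positivity, fun x hx => ?_⟩
  · simp only [neg_div, hf.even]
  · intro x hx y hy hxy
    simp only [Set.mem_Ici] at hx hy
    refine mul_le_mul_of_nonneg_left (hf.antitoneOn ?_ ?_ ?_) (by positivity)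
    · exact div_nonneg hx hε.le
    · exact div_nonneg hy hε.le
    · gcongr
  · refine continuousAt_const.mul (ContinuousAt.comp (g := f) ?_ (by fun_prop))
    simpa using hf.continuousAt
  · rw [hsupp, mul_zero]
    rw [abs_div, abs_of_pos hε]
    exact (lt_div_iff₀ hε).2 hx

lemma integrable_mul (hf : IsEvenBump f) {b : ℝ → ℝ} (hb : Measurable b) {A : ℝ}
    (hA : ∀ y, |b y| ≤ A + |y|) : Integrable (fun y => b y * f y) := by
  obtain ⟨R, hR, hsupp⟩ := hf.support
  refine (hf.integrable.const_mul (A + R)).mono'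
    (hb.aestronglyMeasurable.mul hf.integrable.aestronglyMeasurable)
    (Filter.Eventually.of_forall fun y => ?_)
  rw [Real.norm_eq_abs, abs_mul, abs_of_nonneg (hf.nonneg y)]
  by_cases h : R < |y|
  · simp [hsupp y h]
  · exact mul_le_mul_of_nonneg_right (by linarith [hA y]) (hf.nonneg y)

lemma integrable_abs_sub_mul (hf : IsEvenBump f) (x : ℝ) :
    Integrable (fun y => |x - y| * f y) :=
  hf.integrable_mul (by fun_prop) (fun y => by rw [abs_abs]; exact abs_sub x y)

/-- The convolution of `|·|` with a bump of height at most `1/2` lies below parabolas of unit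
curvature touching it at any prescribed point. -/
lemma exists_quadratic_upper_bound (hf : IsEvenBump f) (h0 : f 0 ≤ 1 / 2) (x : ℝ) :
    ∃ s : ℝ, ∀ x', (∫ y, |x' - y| * f y) ≤
      (∫ y, |x - y| * f y) + (x' - x) * s + (x' - x) ^ 2 / 2 := by
  set σ : ℝ → ℝ := fun y => if y ≤ x then 1 else -1 with hσ
  have hσi : Integrable (fun y => σ y * f y) := by
    refine hf.integrable_mul (A := 1) ?_ fun y => ?_
    · exact Measurable.ite measurableSet_Iic measurable_const measurable_const
    · simp only [hσ]
      split_ifs <;> simp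
  refine ⟨∫ y, σ y * f y, fun x' => ?_⟩
  have hi := hf.integrable_abs_sub_mul
  have key : ∫ y, (|x' - y| * f y - |x - y| * f y - (x' - x) * (σ y * f y))
      ≤ ∫ y, (Set.uIoc x x').indicator (fun y => |x' - y|) y := by
    refine integral_mono (((hi x').sub (hi x)).sub (hσi.const_mul _)) ?_ fun y => ?_
    · rw [integrable_indicator_iff measurableSet_uIoc]
      exact (Continuous.intervalIntegrable (by fun_prop) x x').def'
    · have hy := hf.nonneg y
      have hy' := (hf.le_apply_zero y).trans h0
      have hfac : |x' - y| * f y - |x - y| * f y - (x' - x) * (σ y * f y)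
          = (|x' - y| - |x - y| - (x' - x) * σ y) * f y := by ring
      simp only
      rw [hfac]
      classical
      simp only [hσ, Set.indicator_apply, Set.mem_uIoc]
      rcases le_total x' y with h₁ | h₁ <;> rcases le_or_gt y x with h₂ | h₂ <;>
      [have e := abs_of_nonneg (sub_nonneg.2 h₂); have e := abs_of_neg (sub_neg.2 h₂);
        have e := abs_of_nonneg (sub_nonneg.2 h₂); have e := abs_of_neg (sub_neg.2 h₂)] <;>
      [have e' := abs_of_nonpos (sub_nonpos.2 h₁); have e' := abs_of_nonpos (sub_nonpos.2 h₁);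
        have e' := abs_of_nonneg (sub_nonneg.2 h₁); have e' := abs_of_nonneg (sub_nonneg.2 h₁)] <;>
      rw [e, e'] <;> split_ifs <;> first | nlinarith | grind
  have hval : ∫ y, (Set.uIoc x x').indicator (fun y => |x' - y|) y = (x' - x) ^ 2 / 2 := by
    rw [integral_indicator measurableSet_uIoc]
    rcases le_total x x' with h | h
    · rw [Set.uIoc_of_le h, ← intervalIntegral.integral_of_le h]
      have : ∫ y in x..x', |x' - y| = ∫ y in x..x', (x' - y) := by
        refine intervalIntegral.integral_congr fun y hy => ?_
        rw [Set.uIcc_of_le h] at hy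
        exact abs_of_nonneg (by linarith [hy.2])
      rw [this, intervalIntegral.integral_sub (by simp) (by simp)]
      simp
      ring
    · rw [Set.uIoc_of_ge h, ← intervalIntegral.integral_of_le h]
      have : ∫ y in x'..x, |x' - y| = ∫ y in x'..x, (y - x') := by
        refine intervalIntegral.integral_congr fun y hy => ?_
        rw [Set.uIcc_of_le h] at hy
        exact (abs_sub_comm _ _).trans <| abs_of_nonneg (by linarith [hy.1])
      rw [this, intervalIntegral.integral_sub (by simp) (by simp)]
      simp
      ring
  rw [hval, integral_sub (by exact (hi x').sub (hi x)) (hσi.const_mul _), integral_sub (hi x') (hi x),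
    integral_const_mul] at key
  linarith

/-- If the convolution of `|·|` with a bump has second differences at `0` bounded by those of
`x ^ 2 / 2`, the bump has height at most `1/2`. -/
lemma apply_zero_le_half (hf : IsEvenBump f)
    (h : ∀ t : ℝ, (∫ y, |t - y| * f y) + (∫ y, |-t - y| * f y) ≤
      t ^ 2 + 2 * ∫ y, |0 - y| * f y) : f 0 ≤ 1 / 2 := by
  by_contra! hlt
  obtain ⟨c, hc, hc0⟩ := exists_between hlt
  obtain ⟨δ, hδ, hball⟩ := Metric.eventually_nhds_iff.1 (hf.continuousAt.eventually_const_lt hc0)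
  set t := δ / 2 with ht
  have htpos : 0 < t := by positivity
  have hcf : ∀ y, |y| ≤ t → c ≤ f y := fun y hy =>
    (hball (by rw [Real.dist_eq, sub_zero]; linarith)).le
  have hi := hf.integrable_abs_sub_mul
  have key : ∫ y, (Set.Ioc (-t) t).indicator (fun y => 2 * c * (t - |y|)) y
      ≤ ∫ y, (|t - y| * f y + |-t - y| * f y - 2 * (|0 - y| * f y)) := by
    refine integral_mono ?_ (((hi t).add (hi (-t))).sub ((hi 0).const_mul 2)) fun y => ?_
    · rw [integrable_indicator_iff measurableSet_Ioc]
      exact (Continuous.integrableOn_Icc (by fun_prop)).mono_set Set.Ioc_subset_Icc_self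
    · have hfac : |t - y| * f y + |-t - y| * f y - 2 * (|0 - y| * f y)
          = (|t - y| + |-t - y| - 2 * |0 - y|) * f y := by ring
      simp only
      rw [hfac, Set.indicator_apply]
      split_ifs with hy
      · have hyt : |y| ≤ t := abs_le.2 ⟨hy.1.le, hy.2⟩
        have e : |t - y| + |-t - y| - 2 * |0 - y| = 2 * (t - |y|) := by
          rw [abs_of_nonneg (show 0 ≤ t - y by linarith [hy.2]),
            abs_of_nonpos (show -t - y ≤ 0 by linarith [hy.1]), zero_sub, abs_neg]
          ring
        rw [e]
        nlinarith [hcf y hyt, sub_nonneg.2 hyt]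
      · refine mul_nonneg ?_ (hf.nonneg y)
        have e := abs_add_le (t - y) (-t - y)
        rw [show t - y + (-t - y) = 2 * (0 - y) by ring, abs_mul, abs_two] at e
        linarith
  have hval : ∫ y, (Set.Ioc (-t) t).indicator (fun y => 2 * c * (t - |y|)) y = 2 * c * t ^ 2 := by
    rw [integral_indicator measurableSet_Ioc,
      ← intervalIntegral.integral_of_le (by linarith), intervalIntegral.integral_const_mul,
      intervalIntegral.integral_sub (by simp) (Continuous.intervalIntegrable (by fun_prop) _ _)]
    have hadd := intervalIntegral.integral_add_adjacent_intervals
      (Continuous.intervalIntegrable (μ := volume) continuous_abs (-t) 0)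
      (Continuous.intervalIntegrable (μ := volume) continuous_abs 0 t)
    have h₁ : ∫ y in (-t)..0, |y| = ∫ y in (-t)..0, -y := by
      refine intervalIntegral.integral_congr fun y hy => ?_
      rw [Set.uIcc_of_le (by linarith)] at hy
      exact abs_of_nonpos hy.2
    have h₂ : ∫ y in (0:ℝ)..t, |y| = ∫ y in (0:ℝ)..t, y := by
      refine intervalIntegral.integral_congr fun y hy => ?_
      rw [Set.uIcc_of_le (by linarith)] at hy
      exact abs_of_nonneg hy.1
    rw [← hadd, h₁, h₂, intervalIntegral.integral_neg]
    simp only [integral_id, intervalIntegral.integral_const, smul_eq_mul]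
    ring
  rw [hval, integral_sub (by exact (hi t).add (hi (-t))) ((hi 0).const_mul 2),
    integral_add (hi t) (hi (-t)), integral_const_mul] at key
  nlinarith [h t, sq_pos_of_pos htpos]

lemma convexOn_integral_abs_sub_mul (hf : IsEvenBump f) :
    ConvexOn ℝ Set.univ (fun x => ∫ y, |x - y| * f y) := by
  refine ⟨convex_univ, fun u _ v _ a b ha hb hab => ?_⟩
  have hi := hf.integrable_abs_sub_mul
  simp only [smul_eq_mul]
  rw [← integral_const_mul, ← integral_const_mul,
    ← integral_add ((hi u).const_mul a) ((hi v).const_mul b)]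
  refine integral_mono (hi _) (((hi u).const_mul a).add ((hi v).const_mul b)) fun y => ?_
  have e : a * u + b * v - y = a * (u - y) + b * (v - y) := by linear_combination y * hab
  have h := abs_add_le (a * (u - y)) (b * (v - y))
  rw [abs_mul, abs_mul, abs_of_nonneg ha, abs_of_nonneg hb, ← e] at h
  simp only
  nlinarith [mul_le_mul_of_nonneg_right h (hf.nonneg y)]

lemma integral_abs_add_sub_mul_le (hf : IsEvenBump f) (x z : ℝ) :
    (∫ y, |x + z - y| * f y) ≤ (∫ y, |x - y| * f y) + |z| * ∫ y, f y := by
  have hi := hf.integrable_abs_sub_mul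
  rw [← integral_const_mul, ← integral_add (hi x) (hf.integrable.const_mul _)]
  refine integral_mono (hi _) ((hi x).add (hf.integrable.const_mul _)) fun y => ?_
  have h := abs_add_le (x - y) z
  rw [show x - y + z = x + z - y by ring] at h
  simp only
  nlinarith [mul_le_mul_of_nonneg_right h (hf.nonneg y)]

end IsEvenBump

/-- A convex function whose increments are dominated by a Lipschitz bound and which lies below
touching parabolas of unit curvature is a Moreau envelope. -/
lemma exists_moreau_envelope_eq {F : ℝ → ℝ} {C : ℝ} (hF : ConvexOn ℝ Set.univ F)
    (hC : ∀ x z, F (x + z) ≤ F x + |z| * C)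
    (hq : ∀ x, ∃ s : ℝ, ∀ x', F x' ≤ F x + (x' - x) * s + (x' - x) ^ 2 / 2) :
    ∃ g : ℝ → ℝ, ConvexOn ℝ Set.univ g ∧ LowerSemicontinuous g ∧
      ∀ x, F x = ⨅ y : ℝ, ((x - y) ^ 2 / 2 + g y) := by
  have hbdd : ∀ y, BddAbove (Set.range fun z => F (y + z) - z ^ 2 / 2) := by
    refine fun y => ⟨F y + C ^ 2 / 2, ?_⟩
    rintro _ ⟨z, rfl⟩
    simp only
    nlinarith [hC y z, sq_nonneg (|z| - C), sq_abs z]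
  set g : ℝ → ℝ := fun y => ⨆ z, (F (y + z) - z ^ 2 / 2) with hg
  have hgle : ∀ y z, F (y + z) - z ^ 2 / 2 ≤ g y := fun y z => le_ciSup (hbdd y) z
  have hgc : ConvexOn ℝ Set.univ g := by
    refine ⟨convex_univ, fun u _ v _ a b ha hb hab => ciSup_le fun z => ?_⟩
    have h := hF.2 (Set.mem_univ (u + z)) (Set.mem_univ (v + z)) ha hb hab
    simp only [smul_eq_mul] at h ⊢
    have e : a * (u + z) + b * (v + z) = a * u + b * v + z := by linear_combination z * hab
    rw [e] at h
    have e' : z ^ 2 / 2 = a * (z ^ 2 / 2) + b * (z ^ 2 / 2) := by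
      linear_combination -(z ^ 2 / 2) * hab
    nlinarith [mul_le_mul_of_nonneg_left (hgle u z) ha, mul_le_mul_of_nonneg_left (hgle v z) hb]
  refine ⟨g, hgc, ?_, fun x => ?_⟩
  · exact (continuousOn_univ.1 (hgc.continuousOn isOpen_univ)).lowerSemicontinuous
  · have hlow : ∀ y, F x ≤ (x - y) ^ 2 / 2 + g y := fun y => by
      have h := hgle y (x - y)
      rw [add_sub_cancel] at h
      linarith
    refine le_antisymm (le_ciInf hlow) ?_
    obtain ⟨s, hs⟩ := hq x
    refine (ciInf_le ⟨F x, by rintro _ ⟨y, rfl⟩; exact hlow y⟩ (x - s)).trans ?_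
    have : g (x - s) ≤ F x - s ^ 2 / 2 := ciSup_le fun z => by
      have h := hs (x - s + z)
      nlinarith
    rw [sub_sub_cancel]
    linarith

/-- Second differences of a Moreau envelope at the origin. -/
lemma ConvexOn.moreau_envelope_second_difference_le {g F : ℝ → ℝ} (hg : ConvexOn ℝ Set.univ g)
    (hgl : LowerSemicontinuous g)
    (hF : ∀ x, F x = ⨅ y : ℝ, ((x - y) ^ 2 / 2 + g y)) (t : ℝ) :
    F t + F (-t) ≤ t ^ 2 + 2 * F 0 := by
  obtain ⟨s, b, hs⟩ := hg.exists_affine_le_real isClosed_univ (hgl.lowerSemicontinuousOn _)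
  have hbdd : ∀ x, BddBelow (Set.range fun y => (x - y) ^ 2 / 2 + g y) := by
    refine fun x => ⟨b + s * x - s ^ 2 / 2, ?_⟩
    rintro _ ⟨y, rfl⟩
    simp only
    nlinarith [hs y (Set.mem_univ y), sq_nonneg (x - y - s)]
  have hle : ∀ x y, F x ≤ (x - y) ^ 2 / 2 + g y := fun x y => (hF x).trans_le (ciInf_le (hbdd x) y)
  have h : (F t + F (-t) - t ^ 2) / 2 ≤ F 0 := by
    rw [hF 0]
    refine le_ciInf fun y => ?_
    nlinarith [hle t y, hle (-t) y]
  linarith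

lemma Mspline_add_two (m : ℕ) :
    Mspline (m + 2) = fun x => ∫ y in (x - 1/2)..(x + 1/2), Mspline (m + 1) y := by
  funext x
  rw [intervalIntegral.integral_of_le (by linarith), ← integral_Icc_eq_integral_Ioc,
    ← integral_indicator measurableSet_Icc]
  simp only [Mspline]
  congr 1
  funext y
  simp only [Set.indicator_apply, Set.mem_Icc, ite_mul, one_mul, zero_mul]
  congr 1
  apply propext
  constructor <;> rintro ⟨h₁, h₂⟩ <;> constructor <;> linarith

lemma isEvenBump_Mspline (m : ℕ) : IsEvenBump (Mspline (m + 1)) := by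
  induction m with
  | zero => simpa only [zero_add, Mspline] using IsEvenBump.indicator_Icc
  | succ m ih =>
    rw [Mspline_add_two]
    exact ih.convolution_box

theorem stmt_10 (m : ℕ) (hm : 1 ≤ m) (ε : ℝ) (hε : 0 < ε) :
    (∃ g : ℝ → ℝ, ConvexOn ℝ Set.univ g ∧ LowerSemicontinuous g ∧
        ∀ x : ℝ, (∫ y, |x - y| * ((1 / ε) * Mspline m (y / ε)))
          = ⨅ y : ℝ, ((x - y) ^ 2 / 2 + g y)) ↔
      2 * Mspline m 0 ≤ ε := by
  obtain ⟨n, rfl⟩ := Nat.exists_eq_add_of_le' hm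
  have hk := (isEvenBump_Mspline n).comp_div hε
  have hiff : (1 / ε) * Mspline (n + 1) (0 / ε) ≤ 1 / 2 ↔ 2 * Mspline (n + 1) 0 ≤ ε := by
    rw [zero_div, one_div_mul_eq_div, div_le_div_iff₀ hε two_pos]
    constructor <;> intro h <;> linarith
  rw [← hiff]
  constructor
  · rintro ⟨g, hg, hgl, hF⟩
    exact hk.apply_zero_le_half (hg.moreau_envelope_second_difference_le hgl hF)
  · intro h
    exact exists_moreau_envelope_eq hk.convexOn_integral_abs_sub_mul
      hk.integral_abs_add_sub_mul_le (hk.exists_quadratic_upper_bound h)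
end

section
/- Let d ≥ 2, r ∈ ℕ, and f : ℝ → ℝ be an even, locally bounded, continuous function that is conditionally positive definite of order r. Then F(‖·‖), with F = I_d[f], is conditionally positive definite of order r on ℝ^d. -/
open MeasureTheory

/-- Surface area of the unit sphere `S^k ⊆ ℝ^(k+1)`. -/
noncomputable def sphArea (k : ℕ) : ℝ :=
  2 * Real.pi ^ (((k : ℝ) + 1) / 2) / Real.Gamma (((k : ℝ) + 1) / 2)

/-- The Riemann--Liouville fractional integral operator `I_d`. -/
noncomputable def RL (d : ℕ) (f : ℝ → ℝ) (s : ℝ) : ℝ :=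
  (2 * sphArea (d - 2) / sphArea (d - 1)) *
    ∫ t in (0:ℝ)..1, f (t * s) * (1 - t ^ 2) ^ (((d : ℝ) - 3) / 2)

open scoped ComplexConjugate

/-- A function `g : ℝ → ℝ` is conditionally positive definite of order `r`. -/
def CondPosDef1 (g : ℝ → ℝ) (r : ℕ) : Prop :=
  ∀ (N : ℕ) (x : Fin N → ℝ) (a : Fin N → ℂ),
    (∀ p : Polynomial ℝ, p.natDegree < r →
      ∑ j, a j * ((Polynomial.eval (x j) p : ℝ) : ℂ) = 0) →
    0 ≤ (∑ j, ∑ k, a j * conj (a k) * (g (x j - x k) : ℂ)).re ∧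
      (∑ j, ∑ k, a j * conj (a k) * (g (x j - x k) : ℂ)).im = 0

/-- A function `g : ℝ^d → ℝ` is conditionally positive definite of order `r`. -/
def CondPosDef (d : ℕ) (g : EuclideanSpace ℝ (Fin d) → ℝ) (r : ℕ) : Prop :=
  ∀ (N : ℕ) (x : Fin N → EuclideanSpace ℝ (Fin d)) (a : Fin N → ℂ),
    (∀ p : MvPolynomial (Fin d) ℝ, p.totalDegree < r →
      ∑ j, a j * ((MvPolynomial.eval (fun i => x j i) p : ℝ) : ℂ) = 0) →
    0 ≤ (∑ j, ∑ k, a j * conj (a k) * (g (x j - x k) : ℂ)).re ∧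
      (∑ j, ∑ k, a j * conj (a k) * (g (x j - x k) : ℂ)).im = 0

/-- The degree-zero homogeneous function `p ↦ f (s * p.1 / ‖p‖₂)` on the plane, cut off to the open
Euclidean unit disc. -/
noncomputable def discCosine (f : ℝ → ℝ) (s : ℝ) (p : ℝ × ℝ) : ℝ :=
  if p.1 ^ 2 + p.2 ^ 2 < 1 then f (s * (p.1 / √(p.1 ^ 2 + p.2 ^ 2))) else 0

theorem image_cos_Ioo_zero_pi_div_two :
    Real.cos '' Set.Ioo 0 (Real.pi / 2) = Set.Ioo 0 1 := by
  ext t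
  constructor
  · rintro ⟨θ, ⟨h0, h1⟩, rfl⟩
    refine ⟨Real.cos_pos_of_mem_Ioo ⟨by linarith, h1⟩, ?_⟩
    simpa using Real.cos_lt_cos_of_nonneg_of_le_pi_div_two le_rfl h1.le h0
  · rintro ⟨h0, h1⟩
    exact ⟨Real.arccos t, ⟨Real.arccos_pos.2 h1, Real.arccos_lt_pi_div_two.2 h0⟩,
      Real.cos_arccos (by linarith) h1.le⟩

theorem integral_sin_pow_mul_comp_cos (n : ℕ) (g : ℝ → ℝ) :
    ∫ θ in (0 : ℝ)..Real.pi / 2, |Real.sin θ| ^ n * g (Real.cos θ) =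
      ∫ t in (0 : ℝ)..1, g t * (1 - t ^ 2) ^ (((n : ℝ) - 1) / 2) := by
  rw [intervalIntegral.integral_of_le zero_le_one, intervalIntegral.integral_of_le (by positivity),
    integral_Ioc_eq_integral_Ioo, integral_Ioc_eq_integral_Ioo, ← image_cos_Ioo_zero_pi_div_two,
    integral_image_eq_integral_abs_deriv_smul measurableSet_Ioo
      (fun θ _ => (Real.hasDerivAt_cos θ).hasDerivWithinAt)]
  · refine setIntegral_congr_fun measurableSet_Ioo fun θ hθ => ?_
    have hs : 0 < Real.sin θ := Real.sin_pos_of_pos_of_lt_pi hθ.1 (by linarith [hθ.2, Real.pi_pos])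
    have h : (1 - Real.cos θ ^ 2) ^ (((n : ℝ) - 1) / 2) * Real.sin θ = Real.sin θ ^ n := by
      rw [← Real.sin_sq, ← Real.rpow_natCast, ← Real.rpow_mul hs.le, ← Real.rpow_add_one hs.ne',
        ← Real.rpow_natCast]
      congr 1
      push_cast
      ring
    simp only [abs_neg, abs_of_pos hs, smul_eq_mul]
    rw [← h]
    ring
  · refine Real.injOn_cos.mono ?_
    exact fun θ hθ => ⟨hθ.1.le, by linarith [hθ.2, Real.pi_pos]⟩

theorem integral_abs_sin_pow_mul_comp_cos (n : ℕ) {g : ℝ → ℝ} (hg : Continuous g)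
    (heven : ∀ x, g (-x) = g x) :
    ∫ θ in Set.Ioo (-Real.pi) Real.pi, |Real.sin θ| ^ n * g (Real.cos θ) =
      4 * ∫ t in (0 : ℝ)..1, g t * (1 - t ^ 2) ^ (((n : ℝ) - 1) / 2) := by
  rw [← integral_sin_pow_mul_comp_cos]
  set h : ℝ → ℝ := fun θ => |Real.sin θ| ^ n * g (Real.cos θ) with hh
  have hc : Continuous h := by fun_prop
  have hi : ∀ a b, IntervalIntegrable h volume a b := fun a b => hc.intervalIntegrable a b
  have h1 : ∫ θ in (-Real.pi)..0, h θ = ∫ θ in (0 : ℝ)..Real.pi, h θ := by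
    have := intervalIntegral.integral_comp_neg (a := 0) (b := Real.pi) h
    rw [neg_zero] at this
    rw [← this]
    simp [hh]
  have h2 : ∫ θ in (Real.pi / 2)..Real.pi, h θ = ∫ θ in (0 : ℝ)..Real.pi / 2, h θ := by
    have := intervalIntegral.integral_comp_sub_left (a := 0) (b := Real.pi / 2) h Real.pi
    rw [sub_zero, sub_half] at this
    rw [← this]
    simp [hh, heven]
  rw [← integral_Ioc_eq_integral_Ioo, ← intervalIntegral.integral_of_le (by linarith [Real.pi_pos]),
    ← intervalIntegral.integral_add_adjacent_intervals (hi (-Real.pi) 0) (hi 0 Real.pi), h1,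
    ← intervalIntegral.integral_add_adjacent_intervals (hi 0 (Real.pi / 2)) (hi _ Real.pi), h2]
  ring

theorem integral_discCosine (n : ℕ) {f : ℝ → ℝ} (hf : Continuous f)
    (heven : ∀ x, f (-x) = f x) (s : ℝ) :
    ∫ p : ℝ × ℝ, |p.2| ^ n * discCosine f s p =
      4 / (n + 2) * ∫ t in (0 : ℝ)..1, f (t * s) * (1 - t ^ 2) ^ (((n : ℝ) - 1) / 2) := by
  rw [← integral_comp_polarCoord_symm, polarCoord_target]
  have h1 : ∀ p ∈ Set.Ioi (0 : ℝ) ×ˢ Set.Ioo (-Real.pi) Real.pi,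
      p.1 • (|(polarCoord.symm p).2| ^ n * discCosine f s (polarCoord.symm p)) =
        (Set.Iio (1 : ℝ)).indicator (fun R => R ^ (n + 1)) p.1 *
          (|Real.sin p.2| ^ n * f (Real.cos p.2 * s)) := by
    rintro ⟨R, θ⟩ ⟨hR, -⟩
    have hR : 0 < R := hR
    have hsq : (R * Real.cos θ) ^ 2 + (R * Real.sin θ) ^ 2 = R ^ 2 := by
      linear_combination R ^ 2 * Real.sin_sq_add_cos_sq θ
    simp only [polarCoord_symm_apply, discCosine, hsq, Real.sqrt_sq hR.le, abs_mul, abs_of_pos hR,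
      smul_eq_mul, Set.indicator, Set.mem_Iio]
    have : R ^ 2 < 1 ↔ R < 1 := by rw [sq_lt_one_iff₀ hR.le]
    simp only [this, mul_div_cancel_left₀ _ hR.ne']
    split_ifs
    · rw [mul_comm s]
      ring
    · simp
  rw [setIntegral_congr_fun (measurableSet_Ioi.prod measurableSet_Ioo) h1, Measure.volume_eq_prod,
    setIntegral_prod_mul _ (fun θ => |Real.sin θ| ^ n * f (Real.cos θ * s)),
    integral_abs_sin_pow_mul_comp_cos n (g := fun t => f (t * s)) (by fun_prop)
      (fun x => by rw [neg_mul, heven]),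
    setIntegral_indicator measurableSet_Iio, Set.Ioi_inter_Iio, ← integral_Ioc_eq_integral_Ioo,
    ← intervalIntegral.integral_of_le zero_le_one, integral_pow]
  push_cast
  rw [one_pow, zero_pow (Nat.succ_ne_zero _)]
  ring

/-- Integrals over `ℝⁿ⁺²` of functions of the first coordinate and of the norm of the remaining
ones reduce to planar integrals. -/
theorem integral_fst_norm_tail (n : ℕ) {G : ℝ × ℝ → ℝ} (hG : Measurable G) {C : ℝ}
    (hC : ∀ p, |G p| ≤ C) (hsupp : ∀ p, 1 ≤ p.1 ^ 2 + p.2 ^ 2 → G p = 0) :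
    ∫ ξ : EuclideanSpace ℝ (Fin (n + 2)), G (ξ 0, √(∑ i : Fin (n + 1), ξ i.succ ^ 2)) =
      (n + 1) * volume.real (Metric.ball (0 : EuclideanSpace ℝ (Fin (n + 1))) 1) / 2 *
        ∫ p : ℝ × ℝ, |p.2| ^ n * G (p.1, |p.2|) := by
  let e : EuclideanSpace ℝ (Fin (n + 2)) ≃ᵐ ℝ × EuclideanSpace ℝ (Fin (n + 1)) :=
    ((MeasurableEquiv.toLp 2 (Fin (n + 2) → ℝ)).symm.trans
      (MeasurableEquiv.piFinSuccAbove (fun _ => ℝ) 0)).trans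
        (MeasurableEquiv.prodCongr (MeasurableEquiv.refl ℝ)
          (MeasurableEquiv.toLp 2 (Fin (n + 1) → ℝ)))
  have he : MeasurePreserving e volume volume :=
    ((MeasurePreserving.id volume).prod (PiLp.volume_preserving_toLp (Fin (n + 1)))).comp
      ((volume_preserving_piFinSuccAbove (fun _ => ℝ) 0).comp
        (PiLp.volume_preserving_ofLp (Fin (n + 2))))
  have h1 : ∀ ξ : EuclideanSpace ℝ (Fin (n + 2)),
      G (ξ 0, √(∑ i : Fin (n + 1), ξ i.succ ^ 2)) = G ((e ξ).1, ‖(e ξ).2‖) := by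
    intro ξ
    rw [EuclideanSpace.norm_eq]
    simp [e, MeasurableEquiv.piFinSuccAbove, MeasurableEquiv.prodCongr, Fin.insertNthEquiv,
      Fin.tail]
  have hbd : ∀ p : ℝ × ℝ, p.1 ^ 2 + p.2 ^ 2 < 1 → |p.1| < 1 ∧ |p.2| < 1 := by
    intro p hp
    simp only [← sq_lt_one_iff_abs_lt_one]
    constructor <;> nlinarith [sq_nonneg p.1, sq_nonneg p.2]
  have hint : Integrable (fun q : ℝ × EuclideanSpace ℝ (Fin (n + 1)) => G (q.1, ‖q.2‖))
      (volume.prod volume) := by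
    rw [← integrableOn_iff_integrable_of_support_subset
      (s := Metric.ball (0 : ℝ) 1 ×ˢ Metric.ball (0 : EuclideanSpace ℝ (Fin (n + 1))) 1)]
    · refine Measure.integrableOn_of_bounded (M := C) ?_ ?_ (ae_of_all _ fun q => hC _)
      · rw [Measure.prod_prod]
        exact ENNReal.mul_ne_top measure_ball_lt_top.ne measure_ball_lt_top.ne
      · exact (hG.comp (by fun_prop)).aestronglyMeasurable
    · intro q hq
      have := hbd (q.1, ‖q.2‖) (not_le.1 fun h => hq (hsupp _ h))
      simpa using this
  have hint2 : Integrable (fun p : ℝ × ℝ => |p.2| ^ n * G (p.1, |p.2|)) (volume.prod volume) := by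
    rw [← integrableOn_iff_integrable_of_support_subset
      (s := Metric.ball (0 : ℝ) 1 ×ˢ Metric.ball (0 : ℝ) 1)]
    · refine Measure.integrableOn_of_bounded (M := C) ?_ ?_ ?_
      · rw [Measure.prod_prod]
        exact ENNReal.mul_ne_top measure_ball_lt_top.ne measure_ball_lt_top.ne
      · have : Measurable fun p : ℝ × ℝ => G (p.1, |p.2|) := hG.comp (by fun_prop)
        exact Measurable.aestronglyMeasurable (by fun_prop)
      · refine (ae_restrict_iff' (measurableSet_ball.prod measurableSet_ball)).2
          (ae_of_all _ fun p hp => ?_)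
        have hp2 : |p.2| < 1 := by simpa using hp.2
        rw [Real.norm_eq_abs, abs_mul, abs_of_nonneg (by positivity : 0 ≤ |p.2| ^ n)]
        exact (mul_le_of_le_one_left (abs_nonneg _)
          (pow_le_one₀ (abs_nonneg _) hp2.le)).trans (hC _)
    · intro p hp
      have := hbd (p.1, |p.2|) (not_le.1 fun h => hp (by simp [hsupp _ h]))
      simpa using this
  simp_rw [h1]
  rw [he.integral_comp' (fun q => G (q.1, ‖q.2‖)), Measure.volume_eq_prod, Measure.volume_eq_prod,
    integral_prod _ hint, integral_prod _ hint2, ← integral_const_mul]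
  refine integral_congr_ae (ae_of_all _ fun u => ?_)
  have h2 := integral_fun_norm_addHaar (volume : Measure (EuclideanSpace ℝ (Fin (n + 1))))
    (fun ρ => G (u, ρ))
  have h3 := integral_comp_abs (f := fun ρ => ρ ^ n * G (u, ρ))
  simp only [finrank_euclideanSpace, Fintype.card_fin, Nat.add_sub_cancel, nsmul_eq_mul,
    smul_eq_mul, Nat.cast_add, Nat.cast_one] at h2
  simp only [h2, h3]
  ring

/-- The zonal function `ξ ↦ f ⟪x, ξ / ‖ξ‖⟫` is integrable on the unit ball. -/
theorem integrableOn_ball_zonal {d : ℕ} {f : ℝ → ℝ} (hf : Continuous f)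
    (x : EuclideanSpace ℝ (Fin d)) :
    IntegrableOn (fun ξ : EuclideanSpace ℝ (Fin d) => f (inner ℝ x (‖ξ‖⁻¹ • ξ)))
      (Metric.ball 0 1) := by
  obtain ⟨C, hC⟩ := (isCompact_Icc (a := -‖x‖) (b := ‖x‖)).exists_bound_of_continuousOn
    hf.continuousOn
  refine Measure.integrableOn_of_bounded (M := C) measure_ball_lt_top.ne
    (hf.measurable.comp (by fun_prop)).aestronglyMeasurable (ae_of_all _ fun ξ => hC _ ?_)
  refine abs_le.1 ((abs_real_inner_le_norm _ _).trans
    (mul_le_of_le_one_right (norm_nonneg _) ?_))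
  rw [norm_smul, norm_inv, norm_norm]
  exact inv_mul_le_one

theorem integral_ball_zonal_single (n : ℕ) {f : ℝ → ℝ} (hf : Continuous f)
    (s : ℝ) :
    ∫ ξ in Metric.ball (0 : EuclideanSpace ℝ (Fin (n + 2))) 1,
        f (inner ℝ (EuclideanSpace.single 0 s) (‖ξ‖⁻¹ • ξ)) =
      (n + 1) * volume.real (Metric.ball (0 : EuclideanSpace ℝ (Fin (n + 1))) 1) / 2 *
        ∫ p : ℝ × ℝ, |p.2| ^ n * discCosine f s p := by
  obtain ⟨C, hC⟩ := (isCompact_Icc (a := -|s|) (b := |s|)).exists_bound_of_continuousOn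
    hf.continuousOn
  have hC0 : 0 ≤ C := (norm_nonneg _).trans (hC 0 (by simp))
  have h := integral_fst_norm_tail n (G := discCosine f s) (C := C) ?_ ?_ ?_
  · simp only [discCosine, sq_abs] at h ⊢
    rw [← h, ← integral_indicator measurableSet_ball]
    congr 1 with ξ
    have hn : ‖ξ‖ = √(ξ 0 ^ 2 + ∑ i : Fin (n + 1), ξ i.succ ^ 2) := by
      rw [EuclideanSpace.norm_eq, Fin.sum_univ_succ]
      simp
    have h0 : 0 ≤ ∑ i : Fin (n + 1), ξ i.succ ^ 2 := Finset.sum_nonneg fun i _ => sq_nonneg _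
    rw [Real.sq_sqrt h0, ← hn]
    have hlt : ξ 0 ^ 2 + ∑ i : Fin (n + 1), ξ i.succ ^ 2 < 1 ↔ ‖ξ‖ < 1 := by
      rw [hn, Real.sqrt_lt' one_pos, one_pow]
    simp only [hlt, Set.indicator, mem_ball_zero_iff]
    split_ifs
    · congr 1
      simp only [EuclideanSpace.inner_single_left, conj_trivial, PiLp.smul_apply, smul_eq_mul]
      ring
    · rfl
  · refine Measurable.ite (measurableSet_lt (by fun_prop) (by fun_prop)) ?_ measurable_const
    exact hf.measurable.comp (by fun_prop)
  · intro p
    unfold discCosine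
    split_ifs
    · refine hC _ (abs_le.1 ?_)
      rw [abs_mul]
      refine mul_le_of_le_one_right (abs_nonneg _) ?_
      rw [abs_div, abs_of_nonneg (Real.sqrt_nonneg _)]
      exact div_le_one_of_le₀ (Real.abs_le_sqrt (by nlinarith [sq_nonneg p.2])) (Real.sqrt_nonneg _)
    · simpa using hC0
  · intro p hp
    exact if_neg hp.not_gt

theorem integral_ball_zonal_of_norm_eq {d : ℕ} (f : ℝ → ℝ) {x y : EuclideanSpace ℝ (Fin d)}
    (h : ‖x‖ = ‖y‖) :
    ∫ ξ in Metric.ball (0 : EuclideanSpace ℝ (Fin d)) 1, f (inner ℝ x (‖ξ‖⁻¹ • ξ)) =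
      ∫ ξ in Metric.ball (0 : EuclideanSpace ℝ (Fin d)) 1, f (inner ℝ y (‖ξ‖⁻¹ • ξ)) := by
  set T := (ℝ ∙ (x - y))ᗮ.reflection with hT
  have hTx : T x = y := Submodule.reflection_sub h
  symm
  rw [← integral_indicator measurableSet_ball, ← integral_indicator measurableSet_ball,
    ← T.measurePreserving.integral_comp T.toHomeomorph.measurableEmbedding]
  congr 1 with ξ
  simp only [Set.indicator, mem_ball_zero_iff, T.norm_map]
  rw [← hTx, ← T.map_smul, T.inner_map_map]

theorem MvPolynomial.totalDegree_aeval_le {R σ : Type*} [CommSemiring R] {q : MvPolynomial σ R}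
    (hq : q.totalDegree ≤ 1) (p : Polynomial R) :
    (Polynomial.aeval q p).totalDegree ≤ p.natDegree := by
  rw [Polynomial.aeval_eq_sum_range]
  refine MvPolynomial.totalDegree_finsetSum_le fun i hi => ?_
  refine (MvPolynomial.totalDegree_smul_le _ _).trans ((MvPolynomial.totalDegree_pow _ _).trans ?_)
  rw [Finset.mem_range] at hi
  nlinarith

theorem sum_eval_inner_eq_zero {d r N : ℕ} {x : Fin N → EuclideanSpace ℝ (Fin d)} {a : Fin N → ℂ}
    (ha : ∀ p : MvPolynomial (Fin d) ℝ, p.totalDegree < r →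
      ∑ j, a j * ((MvPolynomial.eval (fun i => x j i) p : ℝ) : ℂ) = 0)
    (v : EuclideanSpace ℝ (Fin d)) (p : Polynomial ℝ) (hp : p.natDegree < r) :
    ∑ j, a j * ((Polynomial.eval (inner ℝ (x j) v) p : ℝ) : ℂ) = 0 := by
  set q : MvPolynomial (Fin d) ℝ := ∑ i, MvPolynomial.C (v i) * MvPolynomial.X i with hq
  have hq1 : q.totalDegree ≤ 1 := by
    refine MvPolynomial.totalDegree_finsetSum_le fun i _ => ?_
    exact (MvPolynomial.totalDegree_mul _ _).trans (by simp)
  have := ha (Polynomial.aeval q p) ((MvPolynomial.totalDegree_aeval_le hq1 p).trans_lt hp)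
  convert this using 4 with j
  have hev : MvPolynomial.eval (fun i => x j i) q = inner ℝ (x j) v := by
    simp [hq, PiLp.inner_apply]
  rw [← hev, Polynomial.aeval_def, Polynomial.hom_eval₂,
    show (MvPolynomial.eval fun i => x j i).comp (algebraMap ℝ (MvPolynomial (Fin d) ℝ)) =
      RingHom.id ℝ by ext; simp]
  rfl

theorem sphArea_nonneg (k : ℕ) : 0 ≤ sphArea k := by
  unfold sphArea
  have := Real.Gamma_pos_of_pos (s := ((k : ℝ) + 1) / 2) (by positivity)
  positivity

/-- The slicing identity, up to normalisation. -/
theorem exists_RL_norm_eq_integral_ball (n : ℕ) {f : ℝ → ℝ} (hf : Continuous f)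
    (heven : ∀ x, f (-x) = f x) :
    ∃ c : ℝ, 0 ≤ c ∧ ∀ x : EuclideanSpace ℝ (Fin (n + 2)),
      RL (n + 2) f ‖x‖ = c * ∫ ξ in Metric.ball (0 : EuclideanSpace ℝ (Fin (n + 2))) 1,
        f (inner ℝ x (‖ξ‖⁻¹ • ξ)) := by
  set κ := (n + 1) * volume.real (Metric.ball (0 : EuclideanSpace ℝ (Fin (n + 1))) 1) / 2 *
    (4 / ((n : ℝ) + 2)) with hκ
  have hb : 0 < volume.real (Metric.ball (0 : EuclideanSpace ℝ (Fin (n + 1))) 1) :=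
    ENNReal.toReal_pos (Metric.measure_ball_pos _ _ one_pos).ne' measure_ball_lt_top.ne
  have hκ0 : 0 < κ := by positivity
  have h1 := sphArea_nonneg n
  have h2 := sphArea_nonneg (n + 1)
  refine ⟨2 * sphArea n / sphArea (n + 1) / κ, by positivity, fun x => ?_⟩
  rw [integral_ball_zonal_of_norm_eq f (y := EuclideanSpace.single 0 ‖x‖) (by simp),
    integral_ball_zonal_single n hf, integral_discCosine n hf heven, ← mul_assoc _ (4 / _) _, ← hκ,
    ← mul_assoc, div_mul_cancel₀ _ hκ0.ne', RL]
  congr 3 with t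
  push_cast
  ring_nf

theorem stmt_13 (d : ℕ) (hd : 2 ≤ d) (r : ℕ) (f : ℝ → ℝ)
    (heven : ∀ x, f (-x) = f x) (hcont : Continuous f)
    (hloc : ∀ ρ : ℝ, 0 < ρ → ∃ C : ℝ, ∀ x ∈ Set.Icc (-ρ) ρ, |f x| ≤ C)
    (hcpd : CondPosDef1 f r) :
    CondPosDef d (fun x => RL d f ‖x‖) r := by
  obtain ⟨n, rfl⟩ := Nat.exists_eq_add_of_le' hd
  obtain ⟨c, hc, hRL⟩ := exists_RL_norm_eq_integral_ball n hcont heven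
  intro N x a ha
  have hslice := fun ξ : EuclideanSpace ℝ (Fin (n + 2)) =>
    hcpd N (fun j => inner ℝ (x j) (‖ξ‖⁻¹ • ξ)) a (sum_eval_inner_eq_zero ha _)
  have key : ∀ b : Fin N → Fin N → ℝ, ∑ j, ∑ k, b j k * RL (n + 2) f ‖x j - x k‖ =
      c * ∫ ξ in Metric.ball (0 : EuclideanSpace ℝ (Fin (n + 2))) 1, ∑ j, ∑ k,
        b j k * f (inner ℝ (x j) (‖ξ‖⁻¹ • ξ) - inner ℝ (x k) (‖ξ‖⁻¹ • ξ)) := by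
    intro b
    have hi := fun j k => (integrableOn_ball_zonal hcont (x j - x k)).const_mul (b j k)
    simp_rw [← inner_sub_left]
    rw [integral_finsetSum _ fun j _ => integrable_finsetSum _ fun k _ => hi j k, Finset.mul_sum]
    refine Finset.sum_congr rfl fun j _ => ?_
    rw [integral_finsetSum _ fun k _ => hi j k, Finset.mul_sum]
    refine Finset.sum_congr rfl fun k _ => ?_
    rw [integral_const_mul, hRL]
    ring
  simp only [Complex.re_sum, Complex.im_sum, Complex.re_mul_ofReal, Complex.im_mul_ofReal]
    at hslice ⊢
  rw [key fun j k => (a j * conj (a k)).re, key fun j k => (a j * conj (a k)).im]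
  refine ⟨mul_nonneg hc (integral_nonneg fun ξ => (hslice ξ).1), ?_⟩
  simp only [(hslice _).2, integral_zero, mul_zero]
end

section
/- Let u be continuous, even, nonnegative with compact support and unit integral, and Φ(x) = −I_d[abs*u](‖x‖) on ℝ^d. Then ∇Φ is Lipschitz continuous with constant L = 2√d ‖u‖_∞, i.e., ‖∇Φ(x) − ∇Φ(y)‖ ≤ 2√d ‖u‖_∞ ‖x−y‖ for all x, y ∈ ℝ^d. -/
open MeasureTheory

section Radial

variable {E : Type*} [NormedAddCommGroup E] [InnerProductSpace ℝ E]

/-- A radial field with an `L`-Lipschitz profile vanishing at the origin is `L`-Lipschitz. -/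
theorem norm_radial_sub_le {h : ℝ → ℝ} {L : ℝ} (hL : ∀ a b, |h a - h b| ≤ L * |a - b|)
    (h0 : h 0 = 0) (x y : E) :
    ‖(h ‖x‖ / ‖x‖) • x - (h ‖y‖ / ‖y‖) • y‖ ≤ L * ‖x - y‖ := by
  have hL0 : 0 ≤ L := by simpa using (abs_nonneg _).trans (hL 1 0)
  have hbound (z : E) : |h ‖z‖| ≤ L * ‖z‖ := by simpa [h0] using hL ‖z‖ 0
  rcases eq_or_ne x 0 with rfl | hx
  · rcases eq_or_ne y 0 with rfl | hy
    · simp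
    · have hy' := norm_pos_iff.2 hy
      simpa [norm_smul, hy'.ne'] using hbound y
  rcases eq_or_ne y 0 with rfl | hy
  · have hx' := norm_pos_iff.2 hx
    simpa [norm_smul, hx'.ne'] using hbound x
  have hx' := norm_pos_iff.2 hx
  have hy' := norm_pos_iff.2 hy
  refine abs_le_of_sq_le_sq' ?_ (by positivity) |>.2
  rw [mul_pow, norm_sub_sq_real, norm_sub_sq_real, norm_smul, norm_smul, real_inner_smul_left,
    real_inner_smul_right]
  set a := ‖x‖
  set b := ‖y‖
  set p := inner ℝ x y
  have hp : p ≤ a * b := real_inner_le_norm x y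
  have hab : h a * h b ≤ L ^ 2 * (a * b) :=
    calc h a * h b ≤ |h a| * |h b| := by rw [← abs_mul]; exact le_abs_self _
      _ ≤ (L * a) * (L * b) := mul_le_mul (hbound x) (hbound y) (abs_nonneg _) (by positivity)
      _ = L ^ 2 * (a * b) := by ring
  have hsq : (h a - h b) ^ 2 ≤ L ^ 2 * (a - b) ^ 2 := by
    have := pow_le_pow_left₀ (abs_nonneg _) (hL a b) 2
    simpa [mul_pow, sq_abs] using this
  have e1 : ‖h a / a‖ * a = |h a| := by
    rw [norm_div, Real.norm_eq_abs, Real.norm_eq_abs, abs_of_pos hx', div_mul_cancel₀ _ hx'.ne']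
  have e2 : ‖h b / b‖ * b = |h b| := by
    rw [norm_div, Real.norm_eq_abs, Real.norm_eq_abs, abs_of_pos hy', div_mul_cancel₀ _ hy'.ne']
  rw [e1, e2, sq_abs, sq_abs]
  have hq : 0 ≤ 1 - p / (a * b) := by
    rw [sub_nonneg, div_le_one (by positivity)]; exact hp
  have key := mul_le_mul_of_nonneg_right hab hq
  have e3 : h a / a * (h b / b * p) = h a * h b * (p / (a * b)) := by field_simp
  have e4 : L ^ 2 * (a * b) * (1 - p / (a * b)) = L ^ 2 * (a * b) - L ^ 2 * p := by
    field_simp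
  rw [e3]
  linarith

variable [CompleteSpace E]

/-- The gradient of a radial function whose profile has vanishing derivative at the origin. -/
theorem hasGradientAt_comp_norm {g h : ℝ → ℝ} (hg : ∀ s, HasDerivAt g (h s) s) (h0 : h 0 = 0)
    (x : E) : HasGradientAt (fun z : E => g ‖z‖) ((h ‖x‖ / ‖x‖) • x) x := by
  rw [hasGradientAt_iff_hasFDerivAt]
  rcases eq_or_ne x 0 with rfl | hx
  · have h1 := hg 0
    rw [h0, hasDerivAt_iff_isLittleO] at h1
    rw [hasFDerivAt_iff_isLittleO]
    have h2 := (h1.comp_tendsto (k := fun z : E => ‖z‖)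
      (Filter.Tendsto.mono_right (by simpa using (continuous_norm (E := E)).tendsto 0) le_rfl))
    simp only [Function.comp_def, sub_zero, smul_zero] at h2
    simpa using h2.of_norm_right
  · have hx' := norm_pos_iff.2 hx
    have h1 : HasFDerivAt (fun z : E => √(‖z‖ ^ 2)) _ x :=
      (hasStrictFDerivAt_norm_sq x).hasFDerivAt.sqrt (by positivity)
    simp only [norm_nonneg, Real.sqrt_sq] at h1
    have h2 := (hg ‖x‖).comp_hasFDerivAt x h1
    simp only [Function.comp_def] at h2
    refine h2.congr_fderiv ?_
    ext z
    simp
    field_simp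

end Radial

/-- Differentiation under the integral sign for a weighted average of dilations. -/
theorem hasDerivAt_integral_dilation {F G w : ℝ → ℝ} {K : ℝ}
    (hF : ∀ x, HasDerivAt F (G x) x) (hG : ∀ a b, |G a - G b| ≤ K * |a - b|) (hG0 : G 0 = 0)
    (hw : IntervalIntegrable w volume 0 1) (s : ℝ) :
    HasDerivAt (fun s => ∫ t in (0 : ℝ)..1, F (t * s) * w t)
      (∫ t in (0 : ℝ)..1, t * G (t * s) * w t) s := by
  have hK : 0 ≤ K := by simpa using (abs_nonneg _).trans (hG 1 0)
  have hFc : Continuous F := continuous_iff_continuousAt.2 fun x => (hF x).continuousAt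
  have hGc : Continuous G :=
    (LipschitzWith.of_dist_le_mul (K := ⟨K, hK⟩) fun a b => hG a b).continuous
  have hwm : AEStronglyMeasurable w (volume.restrict (Set.uIoc 0 1)) := by
    rw [Set.uIoc_of_le zero_le_one]; exact hw.1.aestronglyMeasurable
  refine (intervalIntegral.hasDerivAt_integral_of_dominated_loc_of_deriv_le
    (F := fun s t => F (t * s) * w t) (F' := fun s t => t * G (t * s) * w t)
    (bound := fun t => K * (|s| + 1) * |w t|) (Metric.ball_mem_nhds s one_pos)
    (.of_forall fun x => ?_) ?_ ?_ ?_ ?_ ?_).2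
  · exact (Continuous.aestronglyMeasurable (by fun_prop)).mul hwm
  · exact hw.continuousOn_mul (by fun_prop)
  · exact (Continuous.aestronglyMeasurable (by fun_prop)).mul hwm
  · refine .of_forall fun t ht x hx => ?_
    rw [Set.uIoc_of_le zero_le_one] at ht
    have hx' : |x| ≤ |s| + 1 := by
      have h1 : |x - s| < 1 := by simpa [Real.dist_eq] using hx
      have h2 := abs_sub_abs_le_abs_sub x s
      linarith
    have h1 : |G (t * x)| ≤ K * |t * x| := by simpa [hG0] using hG (t * x) 0
    rw [norm_mul, norm_mul, Real.norm_eq_abs, Real.norm_eq_abs, Real.norm_eq_abs]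
    refine mul_le_mul_of_nonneg_right ?_ (abs_nonneg _)
    rw [abs_mul] at h1
    have ht' : |t| ≤ 1 := by rw [abs_of_pos ht.1]; exact ht.2
    calc |t| * |G (t * x)| ≤ 1 * (K * (1 * (|s| + 1))) := by
          gcongr
          exact h1.trans (by gcongr)
      _ = K * (|s| + 1) := by ring
  · exact hw.abs.const_mul _
  · refine .of_forall fun t _ x _ => ?_
    have h1 : HasDerivAt (fun x => t * x) t x := by simpa using (hasDerivAt_id x).const_mul t
    have h2 := ((hF (t * x)).comp x h1).mul_const (w t)
    rwa [mul_comm (G (t * x)) t] at h2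

/-- A weighted average of dilations of a Lipschitz function is Lipschitz. -/
theorem abs_integral_dilation_sub_le {G w : ℝ → ℝ} {K : ℝ}
    (hG : ∀ a b, |G a - G b| ≤ K * |a - b|)
    (hw : IntervalIntegrable w volume 0 1) (hw0 : ∀ t ∈ Set.Icc (0 : ℝ) 1, 0 ≤ w t) (a b : ℝ) :
    |(∫ t in (0 : ℝ)..1, t * G (t * a) * w t) - ∫ t in (0 : ℝ)..1, t * G (t * b) * w t|
      ≤ K * (∫ t in (0 : ℝ)..1, w t) * |a - b| := by
  have hK : 0 ≤ K := by simpa using (abs_nonneg _).trans (hG 1 0)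
  have hGc : Continuous G :=
    (LipschitzWith.of_dist_le_mul (K := ⟨K, hK⟩) fun a b => hG a b).continuous
  have hi (s : ℝ) : IntervalIntegrable (fun t => t * G (t * s) * w t) volume 0 1 :=
    hw.continuousOn_mul (by fun_prop)
  rw [← intervalIntegral.integral_sub (hi a) (hi b)]
  have : K * (∫ t in (0 : ℝ)..1, w t) * |a - b| = ∫ t in (0 : ℝ)..1, K * |a - b| * w t := by
    rw [intervalIntegral.integral_const_mul]; ring
  rw [this, ← Real.norm_eq_abs]
  refine intervalIntegral.norm_integral_le_of_norm_le zero_le_one ?_ (hw.const_mul _)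
  refine .of_forall fun t ht => ?_
  have h1 := hG (t * a) (t * b)
  rw [← mul_sub, abs_mul, abs_of_pos ht.1] at h1
  have hwt := hw0 t ⟨ht.1.le, ht.2⟩
  rw [← sub_mul, ← mul_sub, norm_mul, norm_mul, Real.norm_eq_abs, Real.norm_eq_abs,
    Real.norm_eq_abs, abs_of_nonneg hwt, abs_of_pos ht.1]
  refine mul_le_mul_of_nonneg_right ?_ hwt
  calc t * |G (t * a) - G (t * b)| ≤ 1 * (K * (1 * |a - b|)) := by
        gcongr
        · exact ht.2
        · exact h1.trans (by gcongr; exact ht.2)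
    _ = K * |a - b| := by ring

section AbsConvolution

variable {u : ℝ → ℝ}

theorem integrable_sign_sub_mul (hu : Integrable u) (t : ℝ) :
    Integrable fun w => (SignType.sign (t - w) : ℝ) * u w := by
  have hm : Measurable fun x : ℝ => (SignType.sign x : ℝ) := by
    refine Monotone.measurable fun a b hab => ?_
    rcases lt_trichotomy a 0 with h | h | h <;> rcases lt_trichotomy b 0 with h' | h' | h' <;>
      first | (exfalso; linarith) | simp [h, h']
  refine hu.bdd_mul (c := 1) (hm.comp (by fun_prop)).aestronglyMeasurable (.of_forall fun w => ?_)
  · rcases lt_trichotomy (t - w) 0 with h | h | h <;> simp [h]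

/-- The derivative of `abs * u` is `sign * u`. -/
theorem hasDerivAt_integral_abs_sub_mul (hcont : Continuous u) (hsupp : HasCompactSupport u)
    (t : ℝ) :
    HasDerivAt (fun t => ∫ w, |t - w| * u w) (∫ w, (SignType.sign (t - w) : ℝ) * u w) t := by
  have hu := hcont.integrable_of_hasCompactSupport (μ := volume) hsupp
  refine (hasDerivAt_integral_of_dominated_loc_of_lip (μ := volume)
    (F := fun t w => |t - w| * u w)
    (bound := u) Filter.univ_mem (.of_forall fun x => ?_) ?_
    (integrable_sign_sub_mul hu t).aestronglyMeasurable (.of_forall fun w => ?_) hu ?_).2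
  · exact Continuous.aestronglyMeasurable (by fun_prop)
  · exact Continuous.integrable_of_hasCompactSupport (by fun_prop) hsupp.mul_left
  · refine LipschitzOnWith.of_dist_le_mul fun x _ y _ => ?_
    rw [Real.dist_eq, Real.dist_eq, ← sub_mul, abs_mul, mul_comm, Real.coe_nnabs]
    refine mul_le_mul_of_nonneg_left ?_ (abs_nonneg _)
    simpa using abs_abs_sub_abs_le_abs_sub (x - w) (y - w)
  · filter_upwards [Measure.ae_ne volume t] with w hw
    have h1 : HasDerivAt (fun x => x - w) 1 t := (hasDerivAt_id t).sub_const w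
    have h2 := ((hasDerivAt_abs (sub_ne_zero.2 hw.symm)).comp t h1).mul_const (u w)
    simpa using h2

theorem integral_sign_neg_mul_eq_zero (heven : ∀ x, u (-x) = u x) :
    ∫ w, (SignType.sign (0 - w) : ℝ) * u w = 0 := by
  have h := integral_neg_eq_self (fun w => (SignType.sign (0 - w) : ℝ) * u w) volume
  have h2 : ∀ w : ℝ, (SignType.sign (0 - -w) : ℝ) * u (-w)
      = -((SignType.sign (0 - w) : ℝ) * u w) := by
    intro w
    rcases lt_trichotomy w 0 with hw | hw | hw <;> simp [hw, heven]
  simp_rw [h2, integral_neg] at h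
  linarith

theorem abs_integral_sign_sub_mul_sub_le (hu : Integrable u) {M : ℝ} (hM : ∀ x, |u x| ≤ M)
    (a b : ℝ) :
    |(∫ w, (SignType.sign (a - w) : ℝ) * u w) - ∫ w, (SignType.sign (b - w) : ℝ) * u w|
      ≤ 2 * M * |a - b| := by
  rw [← integral_sub (integrable_sign_sub_mul hu a) (integrable_sign_sub_mul hu b)]
  have hM0 : 0 ≤ M := (abs_nonneg _).trans (hM 0)
  have e : 2 * M * |a - b| = ∫ w, (Set.uIcc b a).indicator (fun _ => 2 * M) w := by
    rw [integral_indicator_const _ measurableSet_uIcc]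
    simp [Measure.real, Real.volume_interval, mul_comm]
  rw [e, ← Real.norm_eq_abs]
  refine norm_integral_le_of_norm_le ?_ (.of_forall fun w => ?_)
  · exact (integrable_indicator_iff measurableSet_uIcc).2
      (integrableOn_const (by simp [Real.volume_interval]))
  rw [← sub_mul, norm_mul, Real.norm_eq_abs, Real.norm_eq_abs]
  by_cases hw : w ∈ Set.uIcc b a
  · rw [Set.indicator_of_mem hw]
    refine mul_le_mul ?_ (hM w) (abs_nonneg _) (by norm_num)
    rcases lt_trichotomy (a - w) 0 with h | h | h <;>
      rcases lt_trichotomy (b - w) 0 with h' | h' | h' <;> simp [h, h'] <;> norm_num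
  · rw [Set.indicator_of_notMem hw]
    rw [Set.mem_uIcc, not_or, not_and_or, not_and_or] at hw
    have : SignType.sign (a - w) = SignType.sign (b - w) := by
      rcases lt_trichotomy (a - w) 0 with h | h | h
      · have h' : b - w < 0 := by grind
        simp [h, h']
      · grind
      · have h' : 0 < b - w := by grind
        simp [h, h']
    simp [this]

end AbsConvolution

section Weight

theorem rpow_one_sub_sq_le (k : ℕ) {t : ℝ} (ht : t ∈ Set.Ioo (0 : ℝ) 1) :
    (1 - t ^ 2) ^ (((k : ℝ) - 1) / 2) ≤ (1 - t) ^ (-(1 / 2) : ℝ) := by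
  have h1 : 0 < 1 - t := by linarith [ht.2]
  have h2 : 1 - t ≤ 1 - t ^ 2 := by nlinarith [ht.1, ht.2]
  calc (1 - t ^ 2) ^ (((k : ℝ) - 1) / 2) ≤ (1 - t ^ 2) ^ (-(1 / 2) : ℝ) :=
        Real.rpow_le_rpow_of_exponent_ge (h1.trans_le h2) (by nlinarith [ht.1])
          (by linarith [k.cast_nonneg (α := ℝ)])
    _ ≤ _ := Real.rpow_le_rpow_of_nonpos h1 h2 (by norm_num)

theorem intervalIntegrable_one_sub_rpow :
    IntervalIntegrable (fun t : ℝ => (1 - t) ^ (-(1 / 2) : ℝ)) volume 0 1 := by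
  have := (intervalIntegral.intervalIntegrable_rpow' (a := 0) (b := 1) (r := -(1 / 2))
    (by norm_num)).comp_sub_left 1
  simpa using this.symm

theorem intervalIntegrable_one_sub_sq_rpow (k : ℕ) :
    IntervalIntegrable (fun t : ℝ => (1 - t ^ 2) ^ (((k : ℝ) - 1) / 2)) volume 0 1 := by
  rw [intervalIntegrable_iff_integrableOn_Ioo_of_le zero_le_one]
  refine Integrable.mono' ((intervalIntegrable_iff_integrableOn_Ioo_of_le zero_le_one).1
    intervalIntegrable_one_sub_rpow) (Measurable.aestronglyMeasurable (by fun_prop)) ?_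
  filter_upwards [ae_restrict_mem measurableSet_Ioo] with t ht
  rw [Real.norm_of_nonneg (Real.rpow_nonneg (by nlinarith [ht.1, ht.2]) _)]
  exact rpow_one_sub_sq_le k ht

theorem integral_one_sub_sq_rpow_le_two (k : ℕ) :
    ∫ t in (0 : ℝ)..1, (1 - t ^ 2) ^ (((k : ℝ) - 1) / 2) ≤ 2 := by
  calc _ ≤ ∫ t in (0 : ℝ)..1, (1 - t) ^ (-(1 / 2) : ℝ) :=
        intervalIntegral.integral_mono_on_of_le_Ioo zero_le_one
          (intervalIntegrable_one_sub_sq_rpow k) intervalIntegrable_one_sub_rpow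
          fun t ht => rpow_one_sub_sq_le k ht
    _ = 2 := by
        rw [intervalIntegral.integral_comp_sub_left (fun t : ℝ => t ^ (-(1 / 2) : ℝ)),
          integral_rpow (by norm_num)]
        norm_num

theorem integral_one_sub_sq_rpow_le_one {k : ℕ} (hk : 1 ≤ k) :
    ∫ t in (0 : ℝ)..1, (1 - t ^ 2) ^ (((k : ℝ) - 1) / 2) ≤ 1 := by
  have hk' : (1 : ℝ) ≤ k := by exact_mod_cast hk
  calc _ ≤ ∫ t in (0 : ℝ)..1, (1 : ℝ) :=
        intervalIntegral.integral_mono_on zero_le_one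
          (intervalIntegrable_one_sub_sq_rpow k) intervalIntegrable_const
          fun t ht => Real.rpow_le_one (by nlinarith [ht.1, ht.2]) (by nlinarith [ht.1])
            (by linarith)
    _ = 1 := by simp

theorem sphArea_pos (k : ℕ) : 0 < sphArea k := by
  have := Real.Gamma_pos_of_pos (s := ((k : ℝ) + 1) / 2) (by positivity)
  unfold sphArea
  positivity

/-- `Γ(a + 1/2) ≤ √a Γ(a)`, by log-convexity. -/
theorem Gamma_add_half_le {a : ℝ} (ha : 0 < a) :
    Real.Gamma (a + 1 / 2) ≤ √a * Real.Gamma a := by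
  have h := Real.Gamma_mul_add_mul_le_rpow_Gamma_mul_rpow_Gamma (s := a) (t := a + 1)
    (a := 1 / 2) (b := 1 / 2) ha (by positivity) (by norm_num) (by norm_num) (by norm_num)
  rw [show 1 / 2 * a + 1 / 2 * (a + 1) = a + 1 / 2 by ring, Real.Gamma_add_one ha.ne',
    ← Real.sqrt_eq_rpow, ← Real.sqrt_eq_rpow, Real.sqrt_mul ha.le] at h
  have hs := Real.mul_self_sqrt (Real.Gamma_pos_of_pos ha).le
  calc _ ≤ _ := h
    _ = √a * (√(Real.Gamma a) * √(Real.Gamma a)) := by ring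
    _ = _ := by rw [hs]

theorem sphArea_ratio (k : ℕ) :
    2 * sphArea k / sphArea (k + 1) =
      2 * Real.Gamma (((k : ℝ) + 1) / 2 + 1 / 2) / (√Real.pi * Real.Gamma (((k : ℝ) + 1) / 2)) := by
  have ha : 0 < ((k : ℝ) + 1) / 2 := by positivity
  have g1 := Real.Gamma_pos_of_pos ha
  have g2 := Real.Gamma_pos_of_pos (s := ((k : ℝ) + 1) / 2 + 1 / 2) (by positivity)
  have e : (((k + 1 : ℕ) : ℝ) + 1) / 2 = ((k : ℝ) + 1) / 2 + 1 / 2 := by push_cast; ring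
  unfold sphArea
  rw [e, Real.rpow_add Real.pi_pos, ← Real.sqrt_eq_rpow]
  field_simp

theorem sphArea_ratio_mul_integral_le (k : ℕ) :
    2 * sphArea k / sphArea (k + 1) * ∫ t in (0 : ℝ)..1, (1 - t ^ 2) ^ (((k : ℝ) - 1) / 2)
      ≤ √((k : ℝ) + 2) := by
  have hpi := Real.pi_gt_three
  have hpos : 0 ≤ 2 * sphArea k / sphArea (k + 1) := by
    have := sphArea_pos k
    have := sphArea_pos (k + 1)
    positivity
  rcases k.eq_zero_or_pos with rfl | hk
  · have hr : 2 * sphArea 0 / sphArea (0 + 1) = 2 / Real.pi := by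
      rw [sphArea_ratio]
      norm_num [Real.Gamma_one_half_eq, Real.mul_self_sqrt Real.pi_pos.le]
    have h2 := mul_le_mul_of_nonneg_left (integral_one_sub_sq_rpow_le_two 0) hpos
    refine h2.trans ?_
    rw [hr]
    refine Real.le_sqrt_of_sq_le ?_
    have : 2 / Real.pi ≤ 2 / 3 := by gcongr
    have h3 : 0 ≤ 2 / Real.pi := by positivity
    norm_num
    nlinarith
  · refine (mul_le_mul_of_nonneg_left (integral_one_sub_sq_rpow_le_one hk) hpos).trans ?_
    have ha : 0 < ((k : ℝ) + 1) / 2 := by positivity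
    have g1 := Real.Gamma_pos_of_pos ha
    rw [sphArea_ratio, mul_one]
    calc _ ≤ 2 * (√(((k : ℝ) + 1) / 2) * Real.Gamma (((k : ℝ) + 1) / 2))
            / (√Real.pi * Real.Gamma (((k : ℝ) + 1) / 2)) := by
          gcongr
          exact Gamma_add_half_le ha
      _ = 2 * √(((k : ℝ) + 1) / 2) / √Real.pi := by field_simp
      _ ≤ _ := by
          rw [div_le_iff₀ (by positivity), ← Real.sqrt_mul (by positivity)]
          refine Real.le_sqrt_of_sq_le ?_
          rw [mul_pow, Real.sq_sqrt ha.le]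
          nlinarith [k.cast_nonneg (α := ℝ)]

end Weight

theorem stmt_17 (d : ℕ) (hd : 2 ≤ d) (u : ℝ → ℝ) (hcont : Continuous u)
    (heven : ∀ x, u (-x) = u x) (hnonneg : ∀ x, 0 ≤ u x)
    (hsupp : HasCompactSupport u) (hint : ∫ x, u x = 1) :
    ∀ x y : EuclideanSpace ℝ (Fin d),
      ‖gradient (fun z : EuclideanSpace ℝ (Fin d) =>
            -RL d (fun t => ∫ w, |t - w| * u w) ‖z‖) x
        - gradient (fun z : EuclideanSpace ℝ (Fin d) =>
            -RL d (fun t => ∫ w, |t - w| * u w) ‖z‖) y‖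
        ≤ 2 * Real.sqrt d * (⨆ t : ℝ, u t) * ‖x - y‖ := by
  obtain ⟨k, rfl⟩ := Nat.exists_eq_add_of_le' hd
  have hu := hcont.integrable_of_hasCompactSupport (μ := volume) hsupp
  have hbdd : BddAbove (Set.range u) := hcont.bddAbove_range_of_hasCompactSupport hsupp
  set M := ⨆ t : ℝ, u t with hM
  have huM (t : ℝ) : |u t| ≤ M := by
    rw [abs_of_nonneg (hnonneg t)]; exact le_ciSup hbdd t
  have hM0 : 0 ≤ M := (abs_nonneg _).trans (huM 0)
  set G : ℝ → ℝ := fun t => ∫ w, (SignType.sign (t - w) : ℝ) * u w with hGdef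
  have hF := hasDerivAt_integral_abs_sub_mul hcont hsupp
  have hG (a b : ℝ) : |G a - G b| ≤ 2 * M * |a - b| := abs_integral_sign_sub_mul_sub_le hu huM a b
  have hG0 : G 0 = 0 := integral_sign_neg_mul_eq_zero heven
  set W : ℝ → ℝ := fun t => (1 - t ^ 2) ^ (((k : ℝ) - 1) / 2) with hW
  have hWi : IntervalIntegrable W volume 0 1 := intervalIntegrable_one_sub_sq_rpow k
  have hW0 : ∀ t ∈ Set.Icc (0 : ℝ) 1, 0 ≤ W t := fun t ht =>
    Real.rpow_nonneg (by nlinarith [ht.1, ht.2]) _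
  set c : ℝ := 2 * sphArea k / sphArea (k + 1) with hc
  have hc0 : 0 ≤ c := by
    have := sphArea_pos k
    have := sphArea_pos (k + 1)
    positivity
  set h : ℝ → ℝ := fun s => -(c * ∫ t in (0 : ℝ)..1, t * G (t * s) * W t) with hh
  have hg (s : ℝ) : HasDerivAt (fun s => -RL (k + 2) (fun t => ∫ w, |t - w| * u w) s) (h s) s := by
    have e : (((k + 2 : ℕ) : ℝ) - 3) / 2 = ((k : ℝ) - 1) / 2 := by push_cast; ring
    simp only [RL, e]
    exact ((hasDerivAt_integral_dilation hF hG hG0 hWi s).const_mul c).neg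
  have hh0 : h 0 = 0 := by simp [hh, hG0]
  have hL (a b : ℝ) : |h a - h b| ≤ 2 * √((k + 2 : ℕ) : ℝ) * M * |a - b| := by
    have h1 := abs_integral_dilation_sub_le hG hWi hW0 a b
    have h2 := sphArea_ratio_mul_integral_le k
    simp only [hh]
    rw [neg_sub_neg, abs_sub_comm, ← mul_sub, abs_mul, abs_of_nonneg hc0]
    calc _ ≤ c * (2 * M * (∫ t in (0 : ℝ)..1, W t) * |a - b|) := by gcongr
      _ = 2 * (c * ∫ t in (0 : ℝ)..1, W t) * M * |a - b| := by ring
      _ ≤ _ := by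
        push_cast
        gcongr
  intro x y
  rw [(hasGradientAt_comp_norm hg hh0 x).gradient, (hasGradientAt_comp_norm hg hh0 y).gradient]
  exact norm_radial_sub_le hL hh0 x y
end
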